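/- arXiv:2304.01339 — 3 statements merged into one kernel-verified Lean document; each statement's English description precedes it below -/
import Mathlib

section
/- Let μ be a Borel probability measure on the Hilbert cube [0,1]^ℕ and let X : [0,1]^ℕ → (A, 𝒜) be a Borel-measurable map, where the σ-algebra 𝒜 is countably generated and contains all singletons. Then there exists a disintegration of μ along X. -/
open MeasureTheory
open scoped ENNReal

/-- A family `ν` of probability measures on `Ω` indexed by `A` is a *disintegration* of
`μ` along a measurable map `X : Ω → A` if (i) `x ↦ ν x B` is measurable for every
measurable `B`; (ii) for `X_*μ`-almost every `x`, `ν x` is concentrated on the fiber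
`{ω | X ω = x}`; and (iii) `∫ f dμ = ∫ (∫ f d(ν x)) d(X_*μ)(x)` for every measurable
`f : Ω → [0,∞]`. -/
def IsDisintegration {Ω A : Type*} [MeasurableSpace Ω] [MeasurableSpace A]
    (μ : Measure Ω) (X : Ω → A) (ν : A → Measure Ω) : Prop :=
  (∀ x, IsProbabilityMeasure (ν x)) ∧
  (∀ B : Set Ω, MeasurableSet B → Measurable fun x => ν x B) ∧
  (∀ᵐ x ∂(μ.map X), ν x {ω | X ω ≠ x} = 0) ∧
  (∀ f : Ω → ℝ≥0∞, Measurable f →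
    ∫⁻ ω, f ω ∂μ = ∫⁻ x, ∫⁻ ω, f ω ∂(ν x) ∂(μ.map X))

open ProbabilityTheory

/-- A countably generated σ-algebra separating points has a measurable diagonal. -/
theorem measurableEq_of_countablyGenerated (A : Type*) [MeasurableSpace A]
    [MeasurableSpace.CountablyGenerated A] [MeasurableSpace.SeparatesPoints A] :
    MeasurableEq A where
  measurableSet_diagonal := by
    have h := MeasurableSpace.measurable_mapNatBool A
    convert! measurableSet_eq_fun (h.comp measurable_fst) (h.comp measurable_snd) using 1
    ext p
    exact (MeasurableSpace.injective_mapNatBool A).eq_iff.symm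

/-- The Hilbert cube is disintegrable: if `μ` is a Borel probability measure on the
Hilbert cube `[0,1]^ℕ` and `X : [0,1]^ℕ → (A, 𝒜)` is a measurable map whose codomain
σ-algebra `𝒜` is countably generated and contains all singletons, then there exists a
disintegration of `μ` along `X`. -/
theorem hilbertCube_disintegrable {A : Type*} [MeasurableSpace A]
    [MeasurableSpace.CountablyGenerated A] [MeasurableSingletonClass A]
    (μ : Measure (ℕ → unitInterval)) [IsProbabilityMeasure μ]
    (X : (ℕ → unitInterval) → A) (hX : Measurable X) :
    ∃ ν : A → Measure (ℕ → unitInterval), IsDisintegration μ X ν := by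
  have := measurableEq_of_countablyGenerated A
  have hm : Measurable fun ω => (X ω, ω) := hX.prodMk measurable_id
  have hd : MeasurableSet {p : A × (ℕ → unitInterval) | X p.2 = p.1} :=
    measurableSet_eq_fun (hX.comp measurable_snd) measurable_fst
  have hκ : μ.map X ⊗ₘ condDistrib id X μ = μ.map fun ω => (X ω, ω) :=
    compProd_map_condDistrib aemeasurable_id
  refine ⟨fun x => condDistrib id X μ x, fun x => inferInstance,
    fun B hB => Kernel.measurable_coe _ hB, ?_, fun f hf => ?_⟩
  · have h : ∀ᵐ p ∂(μ.map X ⊗ₘ condDistrib id X μ), X p.2 = p.1 := by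
      rw [hκ, ae_map_iff hm.aemeasurable hd]
      exact Filter.Eventually.of_forall fun _ => rfl
    exact Measure.ae_ae_of_ae_compProd h
  · have hf2 : Measurable fun p : A × (ℕ → unitInterval) => f p.2 := hf.comp measurable_snd
    rw [← Measure.lintegral_compProd hf2, hκ, lintegral_map hf2 hm]
end

section
/- Let (M, ⊑, •, 1) be a Kripke resource monoid such that 1 ⊑ x for every x ∈ M, and let A ⊆ M be a nonempty downward-closed subset (x ⊑ y and y ∈ A imply x ∈ A). Define the partial operation •' on A by: x •' y = x • y if x • y is defined and lies in A, and undefined otherwise. Then (A, ⊑, •', 1) is a Kripke resource monoid. -/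
/-- The axioms of a Kripke resource monoid, for a partial binary operation
`op : M → M ⇀ M` (encoded via `Option`) and unit `one`, relativized to a carrier set
`A`: the carrier contains the unit and is closed under `op`, `op` is commutative,
`one` is a unit, `op` is associative in the partial sense (in both directions), and
`op` respects the ordering `≤`. -/
def IsKRMOn {M : Type*} [PartialOrder M] (A : Set M)
    (op : M → M → Option M) (one : M) : Prop :=
  one ∈ A ∧
  (∀ x ∈ A, ∀ y ∈ A, ∀ r, op x y = some r → r ∈ A) ∧
  (∀ x ∈ A, ∀ y ∈ A, op x y = op y x) ∧
  (∀ x ∈ A, op one x = some x) ∧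
  (∀ x ∈ A, ∀ y ∈ A, ∀ z ∈ A, ∀ xy xyz, op x y = some xy → op xy z = some xyz →
    ∃ yz, op y z = some yz ∧ op x yz = some xyz) ∧
  (∀ x ∈ A, ∀ y ∈ A, ∀ z ∈ A, ∀ yz xyz, op y z = some yz → op x yz = some xyz →
    ∃ xy, op x y = some xy ∧ op xy z = some xyz) ∧
  (∀ x ∈ A, ∀ x' ∈ A, ∀ y ∈ A, ∀ y' ∈ A, ∀ r', x ≤ x' → y ≤ y' → op x' y' = some r' →
    ∃ r, op x y = some r ∧ r ≤ r')

open scoped Classical in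
/-- The restriction of a partial operation `op` to a subset `A`: `x •' y` is `x • y`
when the latter is defined and lies in `A`, and is undefined otherwise. -/
noncomputable def restrictOp {M : Type*} (A : Set M)
    (op : M → M → Option M) : M → M → Option M :=
  fun x y => (op x y).bind fun r => if r ∈ A then some r else none

theorem restrictOp_eq_some {M : Type*} {A : Set M} {op : M → M → Option M} {x y r : M} :
    restrictOp A op x y = some r ↔ op x y = some r ∧ r ∈ A := by
  classical
  unfold restrictOp
  cases op x y with
  | none => simp
  | some s =>
    by_cases hs : s ∈ A
    · simp only [Option.bind_some, if_pos hs, Option.some.injEq]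
      exact ⟨fun h => ⟨h, h ▸ hs⟩, And.left⟩
    · simp only [Option.bind_some, if_neg hs, Option.some.injEq, reduceCtorEq, false_iff]
      rintro ⟨rfl, h⟩
      exact hs h

/-- In a Kripke resource monoid whose unit is least, a product lies above its right factor. -/
theorem IsKRMOn.right_le {M : Type*} [PartialOrder M] {op : M → M → Option M} {one : M}
    (hK : IsKRMOn Set.univ op one) (hone : ∀ x : M, one ≤ x) {x y r : M}
    (h : op x y = some r) : y ≤ r := by
  obtain ⟨-, -, -, hunit, -, -, hmono⟩ := hK
  obtain ⟨s, hs, hle⟩ :=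
    hmono one trivial x trivial y trivial y trivial r (hone x) le_rfl h
  rw [hunit y trivial, Option.some.injEq] at hs
  exact hs ▸ hle

/-- Restricting a Kripke resource monoid whose unit is a least element to a nonempty
downward-closed subset `A` again yields a Kripke resource monoid, with the partial
operation `x •' y` defined as `x • y` whenever `x • y` is defined and lies in `A`. -/
theorem isKRMOn_restrict {M : Type*} [PartialOrder M]
    (op : M → M → Option M) (one : M)
    (hK : IsKRMOn Set.univ op one)
    (hone : ∀ x : M, one ≤ x)
    (A : Set M) (hne : A.Nonempty)
    (hdc : ∀ x y : M, x ≤ y → y ∈ A → x ∈ A) :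
    IsKRMOn A (restrictOp A op) one := by
  have hright {x y r : M} (h : op x y = some r) : y ≤ r := hK.right_le hone h
  obtain ⟨-, -, hcomm, hunit, hassoc, hassoc', hmono⟩ := hK
  have hleft {x y r : M} (h : op x y = some r) : x ≤ r :=
    hright ((hcomm y trivial x trivial).trans h)
  simp only [IsKRMOn, restrictOp_eq_some]
  refine ⟨?_, fun x _ y _ r h => h.2, ?_, fun x hx => ⟨hunit x trivial, hx⟩, ?_, ?_, ?_⟩
  · obtain ⟨a, ha⟩ := hne
    exact hdc one a (hone a) ha
  · intro x _ y _
    simp only [restrictOp, hcomm x trivial y trivial]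
  · rintro x - y - z - xy xyz ⟨h₁, -⟩ ⟨h₂, hA⟩
    obtain ⟨yz, h₃, h₄⟩ := hassoc x trivial y trivial z trivial xy xyz h₁ h₂
    exact ⟨yz, ⟨h₃, hdc yz xyz (hright h₄) hA⟩, h₄, hA⟩
  · rintro x - y - z - yz xyz ⟨h₁, -⟩ ⟨h₂, hA⟩
    obtain ⟨xy, h₃, h₄⟩ := hassoc' x trivial y trivial z trivial yz xyz h₁ h₂
    exact ⟨xy, ⟨h₃, hdc xy xyz (hleft h₄) hA⟩, h₄, hA⟩
  · rintro x - x' - y - y' - r' hx hy ⟨h, hA⟩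
    obtain ⟨r, hr, hle⟩ := hmono x trivial x' trivial y trivial y' trivial r' hx hy h
    exact ⟨r, ⟨hr, hdc r r' hle hA⟩, hle⟩
end

section
/- Weighted reservoir sampling is correct: let (Ω, ℱ, μ) be a probability space, n ≥ 1, w : Fin n → ℝ with wᵢ > 0 for all i, and let S₁, …, Sₙ : Ω → ℝ be mutually independent random variables each uniformly distributed on [0,1]. Then for every k, μ({ω : for all j ≠ k, S_k(ω)^{1/w_k} > S_j(ω)^{1/w_j}}) = w_k / (∑_j w_j). -/
open MeasureTheory
open scoped ENNReal

lemma measure_restrict_Icc_rpow_lt_rpow {a b x : ℝ} (ha : 0 < a) (hb : 0 < b)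
    (hx : x ∈ Set.Icc (0 : ℝ) 1) :
    volume.restrict (Set.Icc (0 : ℝ) 1) {y : ℝ | y ^ (1 / a) < x ^ (1 / b)} =
      ENNReal.ofReal (x ^ (a / b)) := by
  have hmeas : MeasurableSet {y : ℝ | y ^ (1 / a) < x ^ (1 / b)} :=
    measurableSet_lt (by fun_prop) measurable_const
  have hset : {y : ℝ | y ^ (1 / a) < x ^ (1 / b)} ∩ Set.Icc 0 1 = Set.Ico 0 (x ^ (a / b)) := by
    have hpow : (x ^ (1 / b)) ^ a = x ^ (a / b) := by
      rw [← Real.rpow_mul hx.1]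
      congr 1
      ring
    have hiff {y : ℝ} (hy : 0 ≤ y) : y ^ (1 / a) < x ^ (1 / b) ↔ y < x ^ (a / b) := by
      rw [← hpow, one_div a, Real.rpow_inv_lt_iff_of_pos hy (Real.rpow_nonneg hx.1 _) ha]
    ext y
    simp only [Set.mem_inter_iff, Set.mem_ofPred_eq, Set.mem_Icc, Set.mem_Ico]
    constructor
    · rintro ⟨h, h0, -⟩
      exact ⟨h0, (hiff h0).1 h⟩
    · rintro ⟨h0, h⟩
      exact ⟨(hiff h0).2 h, h0, h.le.trans (Real.rpow_le_one hx.1 hx.2 (by positivity))⟩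
  rw [Measure.restrict_apply hmeas, hset, Real.volume_Ico, sub_zero]

lemma setLIntegral_Icc_ofReal_rpow {c : ℝ} (hc : 0 ≤ c) :
    ∫⁻ x in Set.Icc (0 : ℝ) 1, ENNReal.ofReal (x ^ c) = ENNReal.ofReal (1 / (c + 1)) := by
  have hcont : Continuous fun x : ℝ ↦ x ^ c := Real.continuous_rpow_const hc
  rw [← ofReal_integral_eq_lintegral_ofReal (hcont.continuousOn.integrableOn_Icc)
    ((ae_restrict_iff' measurableSet_Icc).2 (.of_forall fun x hx ↦ Real.rpow_nonneg hx.1 c)),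
    integral_Icc_eq_integral_Ioc, ← intervalIntegral.integral_of_le zero_le_one,
    integral_rpow (Or.inl (by linarith)), Real.one_rpow, Real.zero_rpow (by linarith), sub_zero]

/-- Correctness of weighted reservoir sampling: if `S₁, …, Sₙ` are mutually independent
random variables on a probability space `(Ω, ℱ, μ)`, each uniformly distributed on
`[0,1]`, and `w : Fin n → ℝ` are positive weights (with `n ≥ 1`), then for every `k`,
the probability that `S_k ^ (1 / w_k)` strictly exceeds `S_j ^ (1 / w_j)` for all
`j ≠ k` equals `w_k / ∑ j, w_j`. -/
theorem weighted_reservoir_sampling_correct {Ω : Type*} [MeasurableSpace Ω]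
    (μ : Measure Ω) [IsProbabilityMeasure μ]
    {n : ℕ} (hn : 1 ≤ n) (w : Fin n → ℝ) (hw : ∀ i, 0 < w i)
    (S : Fin n → Ω → ℝ) (hSm : ∀ i, Measurable (S i))
    (hunif : ∀ i, μ.map (S i) = volume.restrict (Set.Icc (0 : ℝ) 1))
    (hindep : ∀ (J : Finset (Fin n)) (E : Fin n → Set ℝ),
      (∀ j ∈ J, MeasurableSet (E j)) →
      μ (⋂ j ∈ J, S j ⁻¹' E j) = ∏ j ∈ J, μ (S j ⁻¹' E j))
    (k : Fin n) :
    μ {ω | ∀ j, j ≠ k → S k ω ^ (1 / w k) > S j ω ^ (1 / w j)} =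
      ENNReal.ofReal (w k / ∑ j, w j) := by
  let J : Finset (Fin n) := Finset.univ.erase k
  let T : Ω → J → ℝ := fun ω j ↦ S j ω
  have hT : Measurable T := measurable_pi_lambda _ fun j ↦ hSm j
  have hS : ProbabilityTheory.iIndepFun S μ :=
    (ProbabilityTheory.iIndepFun_iff_measure_inter_preimage_eq_mul (f := S)).2
      fun J {E} hE ↦ hindep J E hE
  have heval : Measurable fun f : ({k} : Finset (Fin n)) → ℝ ↦
      f ⟨k, Finset.mem_singleton_self k⟩ := measurable_pi_apply _
  have hkT : ProbabilityTheory.IndepFun (S k) T μ :=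
    (hS.indepFun_finset {k} J (by simp [J]) hSm).comp heval measurable_id
  have hmap := (ProbabilityTheory.indepFun_iff_map_prod_eq_prod_map_map
    (hSm k).aemeasurable hT.aemeasurable).1 hkT
  let B : Set (ℝ × (J → ℝ)) := {p | ∀ j : J, p.2 j ^ (1 / w j) < p.1 ^ (1 / w k)}
  have hB : MeasurableSet B := by
    have : B = ⋂ j : J, {p | p.2 j ^ (1 / w j) < p.1 ^ (1 / w k)} := by
      ext p
      simp [B]
    rw [this]
    exact .iInter fun j ↦ measurableSet_lt (by fun_prop) (by fun_prop)
  have hevent : {ω | ∀ j, j ≠ k → S k ω ^ (1 / w k) > S j ω ^ (1 / w j)} =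
      (fun ω ↦ (S k ω, T ω)) ⁻¹' B := by
    ext ω
    simp [B, T, J]
  have hsection (x : ℝ) (hx : x ∈ Set.Icc (0 : ℝ) 1) : μ.map T (Prod.mk x ⁻¹' B) =
      ENNReal.ofReal (x ^ ((∑ j ∈ J, w j) / w k)) := by
    let E : Fin n → Set ℝ := fun j ↦ {y | y ^ (1 / w j) < x ^ (1 / w k)}
    have hE (j) : MeasurableSet (E j) := measurableSet_lt (by fun_prop) measurable_const
    have hpre : T ⁻¹' (Prod.mk x ⁻¹' B) = ⋂ j ∈ J, S j ⁻¹' E j := by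
      ext ω
      simp [B, T, J, E]
    rw [Measure.map_apply hT (measurable_prodMk_left hB), hpre, hindep J E fun j _ ↦ hE j,
      Finset.sum_div, Real.rpow_sum_of_nonneg hx.1 fun j _ ↦ (div_pos (hw j) (hw k)).le,
      ENNReal.ofReal_prod_of_nonneg fun j _ ↦ Real.rpow_nonneg hx.1 _]
    refine Finset.prod_congr rfl fun j _ ↦ ?_
    rw [← Measure.map_apply (hSm j) (hE j), hunif j,
      measure_restrict_Icc_rpow_lt_rpow (hw j) (hw k) hx]
  have hsum : ∑ j, w j = ∑ j ∈ J, w j + w k :=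
    (Finset.sum_erase_add _ _ (Finset.mem_univ k)).symm
  have hJ : 0 ≤ ∑ j ∈ J, w j := Finset.sum_nonneg fun j _ ↦ (hw j).le
  have hk := hw k
  rw [hevent, ← Measure.map_apply ((hSm k).prodMk hT) hB, hmap, Measure.prod_apply hB, hunif k,
    setLIntegral_congr_fun measurableSet_Icc hsection,
    setLIntegral_Icc_ofReal_rpow (by positivity), hsum]
  congr 1
  field_simp
end
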